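/- arXiv:1103.4531 — 4 statements merged into one kernel-verified Lean document; each statement's English description precedes it below -/
import Mathlib

section
/- Let a group G act on ℝ^n such that for each g ∈ G the map x ↦ g•x is smooth, let ρ : G → O(k) be a group homomorphism into the orthogonal group of ℝ^k, and let X_0, X_1, …, X_k : ℝ^n → ℝ^n be smooth vector fields satisfying the equivariance conditions D(g•·)(x)[X_0(x)] = X_0(g•x) and D(g•·)(x)[X_j(x)] = Σ_{i=1}^{k} ⟨e_i, ρ(g)e_j⟩ · X_i(g•x) for all g ∈ G, x ∈ ℝ^n and j = 1,…,k. Then for every smooth G-invariant function f : ℝ^n → ℝ, the function A f := X_0 f + (1/2)·Σ_{j=1}^{k} X_j(X_j f) is again G-invariant, i.e. (A f)(g•x) = (A f)(x) for all g ∈ G and x ∈ ℝ^n. -/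
open scoped BigOperators

/-- The trace of a bilinear array is invariant under an orthogonal change of basis. -/
theorem sum_orthogonal_conj {ι : Type*} [Fintype ι] [DecidableEq ι] {R : Matrix ι ι ℝ}
    (hR : R ∈ Matrix.orthogonalGroup ι ℝ) (B : ι → ι → ℝ) :
    ∑ j, ∑ i, R i j * ∑ l, R l j * B i l = ∑ i, B i i := by
  have hRR : ∀ i l, ∑ j, R i j * R l j = if i = l then 1 else 0 := fun i l => by
    simpa [Matrix.mul_apply, Matrix.one_apply, Matrix.star_apply] using
      congrFun (congrFun ((Matrix.mem_orthogonalGroup_iff ι ℝ).1 hR) i) l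
  rw [Finset.sum_comm]
  refine Finset.sum_congr rfl fun i _ => ?_
  calc ∑ j, R i j * ∑ l, R l j * B i l
      = ∑ l, (∑ j, R i j * R l j) * B i l := by
        simp only [Finset.mul_sum, Finset.sum_mul, mul_assoc]
        exact Finset.sum_comm
    _ = B i i := by simp [hRR]

/-- **Generator invariance in the Equivariant Reduction Theorem.**
If the smooth vector fields `X₀, X₁, …, X_k` on `ℝⁿ` are equivariant with respect to a
smooth `G`-action on `ℝⁿ` and an orthogonal representation `ρ : G → O(k)`, then the
second order operator `A = X₀ + (1/2)∑ Xⱼ Xⱼ` preserves `G`-invariant smooth functions. -/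
theorem stmt2 {n k : ℕ} {G : Type*} [Group G]
    [MulAction G (EuclideanSpace ℝ (Fin n))]
    (hact : ∀ g : G, ContDiff ℝ (⊤ : ℕ∞) (fun x : EuclideanSpace ℝ (Fin n) => g • x))
    (ρ : G →* Matrix.orthogonalGroup (Fin k) ℝ)
    (X0 : EuclideanSpace ℝ (Fin n) → EuclideanSpace ℝ (Fin n))
    (X : Fin k → EuclideanSpace ℝ (Fin n) → EuclideanSpace ℝ (Fin n))
    (hX0smooth : ContDiff ℝ (⊤ : ℕ∞) X0) (hXsmooth : ∀ j, ContDiff ℝ (⊤ : ℕ∞) (X j))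
    (hX0equiv : ∀ (g : G) (x : EuclideanSpace ℝ (Fin n)),
      fderiv ℝ (fun y => g • y) x (X0 x) = X0 (g • x))
    (hXequiv : ∀ (g : G) (x : EuclideanSpace ℝ (Fin n)) (j : Fin k),
      fderiv ℝ (fun y => g • y) x (X j x)
        = ∑ i, ((ρ g : Matrix (Fin k) (Fin k) ℝ) i j) • X i (g • x))
    (f : EuclideanSpace ℝ (Fin n) → ℝ) (hf : ContDiff ℝ (⊤ : ℕ∞) f)
    (hfinv : ∀ (g : G) (x : EuclideanSpace ℝ (Fin n)), f (g • x) = f x) :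
    ∀ (g : G) (x : EuclideanSpace ℝ (Fin n)),
      (fderiv ℝ f (g • x) (X0 (g • x))
          + (1/2 : ℝ) * ∑ j, fderiv ℝ (fun y => fderiv ℝ f y (X j y)) (g • x) (X j (g • x)))
        = fderiv ℝ f x (X0 x)
          + (1/2 : ℝ) * ∑ j, fderiv ℝ (fun y => fderiv ℝ f y (X j y)) x (X j x) := by
  intro g x
  have hφ : Differentiable ℝ (fun y : EuclideanSpace ℝ (Fin n) => g • y) :=
    (hact g).differentiable (by simp)
  have hchain : ∀ h : EuclideanSpace ℝ (Fin n) → ℝ, Differentiable ℝ h → ∀ y v,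
      fderiv ℝ (fun z => h (g • z)) y v
        = fderiv ℝ h (g • y) (fderiv ℝ (fun z => g • z) y v) := fun h hh y v => by
    rw [show (fun z => h (g • z)) = h ∘ fun z => g • z from rfl,
      fderiv_comp y (hh (g • y)) (hφ y)]
    rfl
  have hfg : ∀ y v, fderiv ℝ f y v
      = fderiv ℝ f (g • y) (fderiv ℝ (fun z => g • z) y v) := fun y v => by
    rw [← hchain f (hf.differentiable (by simp))]
    simp only [hfinv]
  have hXf : ∀ j, Differentiable ℝ (fun y => fderiv ℝ f y (X j y)) := fun j =>
    ((hf.fderiv_right (m := 1) (by norm_cast)).differentiable (by simp)).clm_apply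
      ((hXsmooth j).differentiable (by simp))
  have hXfg : ∀ j, (fun y => fderiv ℝ f y (X j y)) = fun y =>
      ∑ i, (ρ g : Matrix (Fin k) (Fin k) ℝ) i j * fderiv ℝ f (g • y) (X i (g • y)) := fun j => by
    funext y
    rw [hfg, hXequiv]
    simp
  have hXXf : ∀ j, fderiv ℝ (fun y => fderiv ℝ f y (X j y)) x (X j x)
      = ∑ i, (ρ g : Matrix (Fin k) (Fin k) ℝ) i j *
          ∑ l, (ρ g : Matrix (Fin k) (Fin k) ℝ) l j *
            fderiv ℝ (fun y => fderiv ℝ f y (X i y)) (g • x) (X l (g • x)) := fun j => by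
    have hdiff : ∀ i, DifferentiableAt ℝ (fun y => fderiv ℝ f (g • y) (X i (g • y))) x :=
      fun i => ((hXf i).comp hφ) x
    rw [hXfg j, fderiv_fun_sum fun i _ => (hdiff i).const_mul _, sum_apply]
    refine Finset.sum_congr rfl fun i _ => ?_
    rw [fderiv_const_mul (hdiff i), smul_apply, smul_eq_mul,
      hchain _ (hXf i), hXequiv]
    simp
  rw [hfg x (X0 x), hX0equiv, Finset.sum_congr rfl fun j _ => hXXf j,
    sum_orthogonal_conj (ρ g).2 fun i l =>
      fderiv ℝ (fun y => fderiv ℝ f y (X i y)) (g • x) (X l (g • x))]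
end

section
/- Let a group G act on ℝ^n such that for each g ∈ G the map x ↦ g•x is smooth, let ρ : G → O(k) be a group homomorphism, and let X_0, X_1, …, X_k : ℝ^n → ℝ^n be smooth vector fields satisfying D(g•·)(x)[X_0(x)] = X_0(g•x) and D(g•·)(x)[X_j(x)] = Σ_{i=1}^{k} ⟨e_i, ρ(g)e_j⟩ · X_i(g•x) for all g, x, j. If c : I → ℝ^n is a differentiable curve on an interval I and ξ_1,…,ξ_k : I → ℝ are controls such that c'(t) = X_0(c(t)) + Σ_{j=1}^{k} ξ_j(t)·X_j(c(t)) for all t ∈ I, then for every g ∈ G the curve t ↦ g•c(t) satisfies (g•c)'(t) = X_0(g•c(t)) + Σ_{i=1}^{k} η_i(t)·X_i(g•c(t)), where η(t) := ρ(g)·ξ(t) ∈ ℝ^k. -/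
open scoped BigOperators

/-- **Equivariance of controlled solutions (deterministic form of `gΓ^{x,W} = Γ^{gx,ρ(g)W}`).**
If the smooth vector fields `X₀, X₁, …, X_k` on `ℝⁿ` are equivariant with respect to a
smooth `G`-action and an orthogonal representation `ρ : G → O(k)`, and a curve `c`
solves the controlled equation `c' = X₀(c) + ∑ ξⱼ Xⱼ(c)` on an interval `I`, then for
every `g ∈ G` the curve `g • c` solves the controlled equation with controls
`η = ρ(g)·ξ`. -/
theorem stmt3 {n k : ℕ} {G : Type*} [Group G]
    [MulAction G (EuclideanSpace ℝ (Fin n))]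
    (hact : ∀ g : G, ContDiff ℝ (⊤ : ℕ∞) (fun x : EuclideanSpace ℝ (Fin n) => g • x))
    (ρ : G →* Matrix.orthogonalGroup (Fin k) ℝ)
    (X0 : EuclideanSpace ℝ (Fin n) → EuclideanSpace ℝ (Fin n))
    (X : Fin k → EuclideanSpace ℝ (Fin n) → EuclideanSpace ℝ (Fin n))
    (hX0smooth : ContDiff ℝ (⊤ : ℕ∞) X0) (hXsmooth : ∀ j, ContDiff ℝ (⊤ : ℕ∞) (X j))
    (hX0equiv : ∀ (g : G) (x : EuclideanSpace ℝ (Fin n)),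
      fderiv ℝ (fun y => g • y) x (X0 x) = X0 (g • x))
    (hXequiv : ∀ (g : G) (x : EuclideanSpace ℝ (Fin n)) (j : Fin k),
      fderiv ℝ (fun y => g • y) x (X j x)
        = ∑ i, ((ρ g : Matrix (Fin k) (Fin k) ℝ) i j) • X i (g • x))
    (I : Set ℝ) (c : ℝ → EuclideanSpace ℝ (Fin n)) (ξ : Fin k → ℝ → ℝ)
    (hc : ∀ t ∈ I, HasDerivAt c (X0 (c t) + ∑ j, ξ j t • X j (c t)) t) :
    ∀ g : G, ∀ t ∈ I,
      HasDerivAt (fun s => g • c s)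
        (X0 (g • c t)
          + ∑ i, (∑ j, ((ρ g : Matrix (Fin k) (Fin k) ℝ) i j) * ξ j t) • X i (g • c t)) t := by
  intro g t ht
  have hg : HasFDerivAt (fun y : EuclideanSpace ℝ (Fin n) => g • y)
      (fderiv ℝ (fun y => g • y) (c t)) (c t) :=
    ((hact g).differentiable (by simp) (c t)).hasFDerivAt
  refine (hg.comp_hasDerivAt t (hc t ht)).congr_deriv ?_
  simp only [map_add, map_sum, map_smul, hX0equiv, hXequiv, Finset.sum_smul, Finset.smul_sum,
    smul_smul]
  rw [Finset.sum_comm]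
  simp only [mul_comm]
end

section
/- Let δ : U → ℝ be a smooth strictly positive function on an open set U ⊆ ℝ^l, let f : U → ℝ be smooth, and let γ ∈ ℝ. If Δf + ⟨∇(log δ), ∇f⟩ = γ·f holds on U, then the function ψ⁺ : ℝ × U → ℝ defined by ψ⁺(t,x) := e^{γt/2}·δ(x)^{1/2}·f(x) satisfies the diffusion equation ∂ψ⁺/∂t (t,x) = (1/2)·( Δ_x ψ⁺(t,x) − δ(x)^{-1/2}·Δ(δ^{1/2})(x)·ψ⁺(t,x) ) for all (t,x) ∈ ℝ × U; in particular ψ⁺ is a stationary solution of this equation with ψ⁺(0,x) = δ(x)^{1/2} f(x). -/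
open scoped BigOperators RealInnerProductSpace

/-- Euclidean Laplacian: sum of second partial derivatives. -/
noncomputable def eLap {l : ℕ} (f : EuclideanSpace ℝ (Fin l) → ℝ)
    (x : EuclideanSpace ℝ (Fin l)) : ℝ :=
  ∑ i, fderiv ℝ (fun y => fderiv ℝ f y (EuclideanSpace.single i 1)) x
    (EuclideanSpace.single i 1)

theorem ContDiffAt.differentiableAt_fderiv_apply {l : ℕ} {u : EuclideanSpace ℝ (Fin l) → ℝ}
    {x : EuclideanSpace ℝ (Fin l)} (hu : ContDiffAt ℝ 2 u x) (v : EuclideanSpace ℝ (Fin l)) :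
    DifferentiableAt ℝ (fun y => fderiv ℝ u y v) x :=
  ((hu.fderiv_right (m := 1) (by norm_num)).differentiableAt (by norm_num)).clm_apply
    (differentiableAt_const v)

theorem eLap_mul {l : ℕ} {u v : EuclideanSpace ℝ (Fin l) → ℝ} {x : EuclideanSpace ℝ (Fin l)}
    (hu : ContDiffAt ℝ 2 u x) (hv : ContDiffAt ℝ 2 v x) :
    eLap (fun y => u y * v y) x = u x * eLap v x + v x * eLap u x
      + 2 * ∑ i, fderiv ℝ u x (EuclideanSpace.single i 1) *
          fderiv ℝ v x (EuclideanSpace.single i 1) := by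
  simp only [eLap, Finset.mul_sum, ← Finset.sum_add_distrib]
  refine Finset.sum_congr rfl fun i _ => ?_
  set e : EuclideanSpace ℝ (Fin l) := EuclideanSpace.single i 1
  have hprod : (fun y => fderiv ℝ (fun z => u z * v z) y e) =ᶠ[nhds x]
      fun y => u y * fderiv ℝ v y e + v y * fderiv ℝ u y e := by
    filter_upwards [hu.eventually (by simp), hv.eventually (by simp)] with y huy hvy
    rw [fderiv_fun_mul (huy.differentiableAt (by norm_num)) (hvy.differentiableAt (by norm_num))]
    simp
  have du := hu.differentiableAt (by norm_num)
  have dv := hv.differentiableAt (by norm_num)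
  have du' := hu.differentiableAt_fderiv_apply e
  have dv' := hv.differentiableAt_fderiv_apply e
  rw [hprod.fderiv_eq, fderiv_fun_add (du.fun_mul dv') (dv.fun_mul du'), fderiv_fun_mul du dv',
    fderiv_fun_mul dv du']
  simp only [add_apply, smul_apply, smul_eq_mul]
  ring

theorem eLap_const_mul {l : ℕ} (c : ℝ) {u : EuclideanSpace ℝ (Fin l) → ℝ}
    {x : EuclideanSpace ℝ (Fin l)} (hu : ContDiffAt ℝ 2 u x) :
    eLap (fun y => c * u y) x = c * eLap u x := by
  rw [eLap_mul contDiffAt_const hu]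
  simp [eLap]

theorem inner_gradient_gradient {l : ℕ} (u v : EuclideanSpace ℝ (Fin l) → ℝ)
    (x : EuclideanSpace ℝ (Fin l)) :
    ⟪gradient u x, gradient v x⟫ = ∑ i, fderiv ℝ u x (EuclideanSpace.single i 1) *
      fderiv ℝ v x (EuclideanSpace.single i 1) := by
  rw [← (EuclideanSpace.basisFun (Fin l) ℝ).sum_inner_mul_inner]
  refine Finset.sum_congr rfl fun i _ => ?_
  rw [real_inner_comm (gradient v x)]
  simp only [gradient, InnerProductSpace.toDual_symm_apply, EuclideanSpace.basisFun_apply]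

theorem two_mul_fderiv_rpow_half {l : ℕ} {δ : EuclideanSpace ℝ (Fin l) → ℝ}
    {x : EuclideanSpace ℝ (Fin l)} (hδ : DifferentiableAt ℝ δ x) (hpos : 0 < δ x)
    (e : EuclideanSpace ℝ (Fin l)) :
    2 * fderiv ℝ (fun y => (δ y) ^ ((1:ℝ)/2)) x e
      = (δ x) ^ ((1:ℝ)/2) * fderiv ℝ (fun y => Real.log (δ y)) x e := by
  rw [(hδ.hasFDerivAt.rpow_const (Or.inl hpos.ne')).fderiv,
    (hδ.hasFDerivAt.log hpos.ne').fderiv]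
  simp only [smul_apply, smul_eq_mul]
  rw [Real.rpow_sub_one hpos.ne']
  ring

theorem eLap_rpow_half_mul {l : ℕ} {δ f : EuclideanSpace ℝ (Fin l) → ℝ}
    {x : EuclideanSpace ℝ (Fin l)} (hδ : ContDiffAt ℝ 2 δ x) (hpos : 0 < δ x)
    (hf : ContDiffAt ℝ 2 f x) :
    eLap (fun y => (δ y) ^ ((1:ℝ)/2) * f y) x
      = (δ x) ^ ((1:ℝ)/2) *
          (eLap f x + ⟪gradient (fun y => Real.log (δ y)) x, gradient f x⟫)
        + f x * eLap (fun y => (δ y) ^ ((1:ℝ)/2)) x := by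
  rw [eLap_mul (hδ.rpow_const_of_ne hpos.ne') hf, inner_gradient_gradient, mul_add,
    Finset.mul_sum, Finset.mul_sum]
  simp only [← mul_assoc,
    two_mul_fderiv_rpow_half (hδ.differentiableAt (by norm_num)) hpos]
  ring

/-- If `f` is an eigenfunction of `Δ⁰ = Δ + ⟨∇ log δ, ∇·⟩` with eigenvalue `γ`, then
`ψ⁺(t,x) = e^{γt/2} δ(x)^{1/2} f(x)` is a stationary solution of the reduced diffusion
equation `∂ψ⁺/∂t = (1/2)(Δψ⁺ - δ^{-1/2} Δ(δ^{1/2}) ψ⁺)`, with `ψ⁺(0,x) = δ(x)^{1/2} f(x)`. -/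
theorem stmt4 {l : ℕ} (U : Set (EuclideanSpace ℝ (Fin l))) (hU : IsOpen U)
    (δ : EuclideanSpace ℝ (Fin l) → ℝ) (hδ : ContDiffOn ℝ (⊤ : ℕ∞) δ U)
    (hδpos : ∀ x ∈ U, 0 < δ x)
    (f : EuclideanSpace ℝ (Fin l) → ℝ) (hf : ContDiffOn ℝ (⊤ : ℕ∞) f U) (γ : ℝ)
    (heig : ∀ x ∈ U,
      eLap f x + ⟪gradient (fun y => Real.log (δ y)) x, gradient f x⟫ = γ * f x)
    (ψ : ℝ → EuclideanSpace ℝ (Fin l) → ℝ)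
    (hψ : ψ = fun t x => Real.exp (γ * t / 2) * (δ x) ^ ((1:ℝ)/2) * f x) :
    (∀ t : ℝ, ∀ x ∈ U,
      deriv (fun s => ψ s x) t
        = (1/2 : ℝ) * (eLap (fun y => ψ t y) x
            - (δ x) ^ (-(1:ℝ)/2) * eLap (fun y => (δ y) ^ ((1:ℝ)/2)) x * ψ t x))
    ∧ ∀ x, ψ 0 x = (δ x) ^ ((1:ℝ)/2) * f x := by
  subst hψ
  refine ⟨fun t x hx => ?_, fun x => by simp⟩
  have hpos := hδpos x hx
  have hle : (2 : WithTop ℕ∞) ≤ ((⊤ : ℕ∞) : WithTop ℕ∞) :=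
    WithTop.coe_le_coe.2 (le_top : (2 : ℕ∞) ≤ ⊤)
  have hδx : ContDiffAt ℝ 2 δ x := (hδ.contDiffAt (hU.mem_nhds hx)).of_le hle
  have hfx : ContDiffAt ℝ 2 f x := (hf.contDiffAt (hU.mem_nhds hx)).of_le hle
  have hderiv : HasDerivAt (fun s => Real.exp (γ * s / 2) * (δ x) ^ ((1:ℝ)/2) * f x)
      (Real.exp (γ * t / 2) * (γ / 2) * (δ x) ^ ((1:ℝ)/2) * f x) t := by
    have h : HasDerivAt (fun s => γ * s / 2) (γ / 2) t := by
      simpa using ((hasDerivAt_id t).const_mul γ).div_const 2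
    exact (h.exp.mul_const _).mul_const _
  have hcancel : (δ x) ^ (-(1:ℝ)/2) * (δ x) ^ ((1:ℝ)/2) = 1 := by
    rw [← Real.rpow_add hpos]
    norm_num
  simp only [mul_assoc (Real.exp _)] at hderiv ⊢
  rw [hderiv.deriv, eLap_const_mul _ ((hδx.rpow_const_of_ne hpos.ne').mul hfx),
    eLap_rpow_half_mul hδx hpos hfx, heig x hx]
  linear_combination (1/2 : ℝ) * eLap (fun y => (δ y) ^ ((1:ℝ)/2)) x *
    Real.exp (γ * t / 2) * f x * hcancel
end

section
/- Let l ≥ 2 and let x ∈ ℝ^l have pairwise distinct coordinates. Then the Euclidean norm of the vector Σ_{1≤i<j≤l} (e_i − e_j)/(x_i − x_j) satisfies ‖ Σ_{1≤i<j≤l} (e_i − e_j)/(x_i − x_j) ‖² = 2 · Σ_{1≤i<j≤l} 1/(x_i − x_j)²; equivalently, all cross terms in the expansion of the square cancel. -/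
/-- A double sum with vanishing diagonal, grouped by unordered pairs of indices. -/
theorem sum_sum_eq_sum_lt_add_swap {ι M : Type*} [Fintype ι] [LinearOrder ι] [AddCommMonoid M]
    (f : ι → ι → M) (hf : ∀ i, f i i = 0) :
    ∑ i, ∑ j, f i j =
      ∑ p ∈ Finset.univ.filter (fun p : ι × ι => p.1 < p.2), (f p.1 p.2 + f p.2 p.1) := by
  have hswap : ∑ p : ι × ι, (if p.1 < p.2 then f p.2 p.1 else 0) =
      ∑ p : ι × ι, (if p.2 < p.1 then f p.1 p.2 else 0) :=
    Fintype.sum_equiv (Equiv.prodComm ι ι) _ _ fun _ => rfl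
  rw [Finset.sum_add_distrib, Finset.sum_filter, Finset.sum_filter, hswap,
    ← Finset.sum_add_distrib, ← Fintype.sum_prod_type']
  refine Finset.sum_congr rfl fun p _ => ?_
  rcases lt_trichotomy p.1 p.2 with h | h | h
  · simp [h, h.not_gt]
  · simp [h, hf]
  · simp [h, h.not_gt]

/-- The cyclic three-term identity for reciprocal differences, including the degenerate cases. -/
theorem cyclic_sum_inv_sub_mul_inv_sub {ι K : Type*} [DecidableEq ι] [Field K] {x : ι → K}
    (hx : Function.Injective x) (i j k : ι) :
    (x k - x i)⁻¹ * (x k - x j)⁻¹ + (x i - x j)⁻¹ * (x i - x k)⁻¹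
        + (x j - x k)⁻¹ * (x j - x i)⁻¹ =
      (if i = j then (x k - x i)⁻¹ ^ 2 else 0) + (if j = k then (x i - x j)⁻¹ ^ 2 else 0)
        + (if k = i then (x j - x k)⁻¹ ^ 2 else 0) := by
  have hsq (a b : K) : (a - b)⁻¹ ^ 2 = (b - a)⁻¹ ^ 2 := by
    rw [← neg_sub b a, inv_neg, neg_sq]
  by_cases hij : i = j
  · subst hij
    by_cases hik : i = k
    · simp [hik]
    · simp [hik, Ne.symm hik, sq]
  by_cases hjk : j = k
  · subst hjk
    simp [hij, Ne.symm hij, sq]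
  by_cases hki : k = i
  · subst hki
    simp [hij, hjk, sq]
  have h1 : x i - x j ≠ 0 := sub_ne_zero.2 (hx.ne hij)
  have h2 : x j - x k ≠ 0 := sub_ne_zero.2 (hx.ne hjk)
  have h3 : x k - x i ≠ 0 := sub_ne_zero.2 (hx.ne hki)
  rw [if_neg hij, if_neg hjk, if_neg hki, ← neg_sub (x j) (x k), ← neg_sub (x k) (x i),
    ← neg_sub (x i) (x j)]
  simp only [inv_neg]
  field_simp
  ring

/-- All cross terms cancel in the sum of squares of the row sums of `(x i - x j)⁻¹`. -/
theorem sum_sq_sum_inv_sub {ι : Type*} [Fintype ι] {x : ι → ℝ}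
    (hx : Function.Injective x) :
    ∑ k, (∑ j, (x k - x j)⁻¹) ^ 2 = ∑ k, ∑ j, (x k - x j)⁻¹ ^ 2 := by
  classical
  have hT : ∑ k, (∑ j, (x k - x j)⁻¹) ^ 2 =
      ∑ k, ∑ i, ∑ j, (x k - x i)⁻¹ * (x k - x j)⁻¹ := by
    simp only [sq, Finset.sum_mul_sum]
  have hcycle (f : ι → ι → ι → ℝ) : ∑ k, ∑ i, ∑ j, f i j k = ∑ k, ∑ i, ∑ j, f k i j := by
    rw [Finset.sum_comm]
    exact Finset.sum_congr rfl fun _ _ => Finset.sum_comm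
  have hsum := Finset.sum_congr (rfl : (Finset.univ : Finset ι) = _) fun k _ =>
    Finset.sum_congr (rfl : (Finset.univ : Finset ι) = _) fun i _ =>
      Finset.sum_congr (rfl : (Finset.univ : Finset ι) = _) fun j _ =>
        cyclic_sum_inv_sub_mul_inv_sub hx i j k
  simp only [Finset.sum_add_distrib] at hsum
  have h1 := hcycle fun a b c => (x a - x b)⁻¹ * (x a - x c)⁻¹
  have h2 := hcycle fun a b c => (x b - x c)⁻¹ * (x b - x a)⁻¹
  have h3 := hcycle fun a b c => if b = c then (x a - x b)⁻¹ ^ 2 else 0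
  have h4 := hcycle fun a b c => if c = a then (x b - x c)⁻¹ ^ 2 else 0
  have hdiag : ∑ k, ∑ i, ∑ j, (if i = j then (x k - x i)⁻¹ ^ 2 else 0) =
      ∑ k, ∑ j, (x k - x j)⁻¹ ^ 2 := by
    simp
  linarith

/-- For `x ∈ ℝ^l` with pairwise distinct coordinates, the cross terms in the expansion
of `‖∑_{i<j} (e_i - e_j)/(x_i - x_j)‖²` cancel:
`‖∑_{i<j} (e_i - e_j)/(x_i - x_j)‖² = 2 ∑_{i<j} 1/(x_i - x_j)²`. -/
theorem stmt8 {l : ℕ} (hl : 2 ≤ l) (x : EuclideanSpace ℝ (Fin l))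
    (hx : ∀ i j : Fin l, i ≠ j → x i ≠ x j) :
    ‖∑ p ∈ Finset.univ.filter (fun p : Fin l × Fin l => p.1 < p.2),
        (x p.1 - x p.2)⁻¹ •
          (EuclideanSpace.single p.1 (1:ℝ) - EuclideanSpace.single p.2 (1:ℝ))‖ ^ 2
      = 2 * ∑ p ∈ Finset.univ.filter (fun p : Fin l × Fin l => p.1 < p.2),
          1 / (x p.1 - x p.2) ^ 2 := by
  have hinj : Function.Injective x := fun i j h => by_contra fun hij => hx i j hij h
  have hvec : ∑ p ∈ Finset.univ.filter (fun p : Fin l × Fin l => p.1 < p.2),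
        (x p.1 - x p.2)⁻¹ •
          (EuclideanSpace.single p.1 (1:ℝ) - EuclideanSpace.single p.2 (1:ℝ)) =
      ∑ i, ∑ j, (x i - x j)⁻¹ • EuclideanSpace.single i (1:ℝ) := by
    rw [sum_sum_eq_sum_lt_add_swap _ (by simp)]
    refine Finset.sum_congr rfl fun p _ => ?_
    rw [← neg_sub (x p.1) (x p.2), inv_neg, neg_smul, smul_sub, sub_eq_add_neg]
  have hcoord (k : Fin l) :
      (∑ i, ∑ j, (x i - x j)⁻¹ • EuclideanSpace.single i (1:ℝ)) k = ∑ j, (x k - x j)⁻¹ := by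
    simp [← Finset.sum_smul, Pi.single_apply]
  rw [hvec, EuclideanSpace.real_norm_sq_eq]
  simp only [hcoord]
  rw [sum_sq_sum_inv_sub hinj, sum_sum_eq_sum_lt_add_swap _ (by simp), Finset.mul_sum]
  refine Finset.sum_congr rfl fun p _ => ?_
  rw [← neg_sub (x p.1) (x p.2), inv_neg, neg_sq, inv_pow, one_div, two_mul]
end
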